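/- Let I ⊂ ℝ be an interval, d, m ≥ 1, and let the coefficients of 𝓐(t) satisfy: q_{ij} and the entries of B_i are continuous on I×ℝ^d and continuously differentiable in x, the entries of C are continuous, the matrices Q, B_i, C are symmetric, and ν₀ := inf_{I×ℝ^d} λ_Q > 0. Assume moreover: (i) B_i = b_i I_m + B̃_i with b_i scalar and |(B̃_i)_{jk}(t,x)| ≤ ξ(t) λ_Q(t,x)^σ for some σ > 0 and some ξ : I → (0,∞); (ii) for a bounded interval J = [s,T] ⊂ I and some β ≥ 1/4, the quantity H := sup_{J×ℝ^d}(Λ_C + β d m² ξ² λ_Q^{2σ−1}) satisfies 0 ≤ H < +∞; (iii) there exist λ > 0 and a positive function φ ∈ C²(ℝ^d) with φ(x) → +∞ as |x| → +∞ and sup_{J×ℝ^d}(𝒜φ − λφ) < +∞. Let p ∈ [1 + 1/(4β), 2], let f ∈ C_b(ℝ^d;ℝ^m), let u be a bounded classical solution of D_t u = 𝓐(t)u on (s,T]×ℝ^d with u(s,·) = f, and let v be a bounded classical solution of the scalar problem D_t v = 𝒜(t)v on (s,T]×ℝ^d with v(s,·) = |f|^p. Then |u(t,x)|^p ≤ e^{pH(t−s)}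 v(t,x) for all t ∈ (s,T] and x ∈ ℝ^d. -/

import Mathlib

open MeasureTheory Set Filter
open scoped BigOperators

/-- Partial derivative in the `i`-th coordinate direction. -/
noncomputable def pd {d : ℕ} {F : Type*} [NormedAddCommGroup F] [NormedSpace ℝ F]
    (f : EuclideanSpace ℝ (Fin d) → F) (x : EuclideanSpace ℝ (Fin d)) (i : Fin d) : F :=
  fderiv ℝ f x (EuclideanSpace.single i 1)

/-- `lam` is the minimum eigenvalue of the symmetric matrix `M` (via the Rayleigh quotient). -/
def IsMinEigen {n : ℕ} (M : Matrix (Fin n) (Fin n) ℝ) (lam : ℝ) : Prop :=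
  (∀ w : Fin n → ℝ, lam * ∑ k, (w k) ^ 2 ≤ ∑ k, ∑ l, M k l * w k * w l) ∧
    ∃ w : Fin n → ℝ, w ≠ 0 ∧ (∑ k, ∑ l, M k l * w k * w l) = lam * ∑ k, (w k) ^ 2

/-- `lam` is the maximum eigenvalue of the symmetric matrix `M` (via the Rayleigh quotient). -/
def IsMaxEigen {n : ℕ} (M : Matrix (Fin n) (Fin n) ℝ) (lam : ℝ) : Prop :=
  (∀ w : Fin n → ℝ, (∑ k, ∑ l, M k l * w k * w l) ≤ lam * ∑ k, (w k) ^ 2) ∧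
    ∃ w : Fin n → ℝ, w ≠ 0 ∧ (∑ k, ∑ l, M k l * w k * w l) = lam * ∑ k, (w k) ^ 2

abbrev Eu (d : ℕ) := EuclideanSpace ℝ (Fin d)

lemma pd_contDiff {d : ℕ} {g : Eu d → ℝ} (hg : ContDiff ℝ 2 g) (j : Fin d) :
    ContDiff ℝ 1 (fun y => pd g y j) := by
  unfold pd
  exact (hg.fderiv_right (m := 1) (by norm_num)).clm_apply contDiff_const

lemma pd_mul {d : ℕ} {a g : Eu d → ℝ} {x : Eu d} (ha : DifferentiableAt ℝ a x)
    (hg : DifferentiableAt ℝ g x) (i : Fin d) :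
    pd (fun y => a y * g y) x i = a x * pd g x i + pd a x i * g x := by
  unfold pd
  rw [fderiv_fun_mul ha hg]
  simp [mul_comm]

/-- expanded form of the scalar operator -/
noncomputable def Lop {d : ℕ} (q : Eu d → Matrix (Fin d) (Fin d) ℝ) (b : Fin d → ℝ)
    (g : Eu d → ℝ) (x : Eu d) : ℝ :=
  (∑ i : Fin d, ∑ j : Fin d, pd (fun y => q y i j * pd g y j) x i) + ∑ i : Fin d, b i * pd g x i

lemma pdq {d : ℕ} {q : Eu d → Matrix (Fin d) (Fin d) ℝ}
    (hq : ∀ i j, ContDiff ℝ 1 (fun x => q x i j)) {g : Eu d → ℝ} (hg : ContDiff ℝ 2 g) (x : Eu d)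
    (i j : Fin d) : pd (fun y => q y i j * pd g y j) x i =
      q x i j * pd (fun y => pd g y j) x i + pd (fun y => q y i j) x i * pd g x j :=
  pd_mul ((hq i j).differentiable (by norm_num) x)
      ((pd_contDiff hg j).differentiable (by norm_num) x) i

lemma clm_coord {d : ℕ} (L : Eu d →L[ℝ] ℝ) (w : Fin d → ℝ) :
    L (WithLp.toLp 2 w) = ∑ i, w i * L (EuclideanSpace.single i 1) := by
  have : (WithLp.toLp 2 w : Eu d) = ∑ i, w i • EuclideanSpace.single i (1:ℝ) := by
    ext j
    simp [Finset.sum_apply, Pi.single_apply]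
  rw [this, map_sum]
  simp

lemma hess_nonpos {d : ℕ} {g : Eu d → ℝ} (hg : ContDiff ℝ 2 g) {x : Eu d}
    (hmax : ∀ y, g y ≤ g x) (w : Fin d → ℝ) :
    ∑ i, ∑ j, w i * w j * pd (fun y => pd g y j) x i ≤ 0 := by
  set W : Eu d := WithLp.toLp 2 w
  have hline : ∀ τ : ℝ, HasDerivAt (fun τ : ℝ => x + τ • W) W τ := fun τ => by
    simpa using ((hasDerivAt_id τ).smul_const W).const_add x
  have h1 : ∀ τ : ℝ, HasDerivAt (fun τ : ℝ => g (x + τ • W)) (∑ j, w j * pd g (x + τ • W) j) τ := by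
    intro τ
    have := ((hg.differentiable (by norm_num) (x + τ • W)).hasFDerivAt).comp_hasDerivAt τ (hline τ)
    rwa [clm_coord] at this
  have hd1 : deriv (fun τ : ℝ => g (x + τ • W)) = fun τ => ∑ j, w j * pd g (x + τ • W) j :=
    funext fun τ => (h1 τ).deriv
  have h2 : HasDerivAt (fun τ : ℝ => ∑ j, w j * pd g (x + τ • W) j)
      (∑ j, w j * ∑ i, w i * pd (fun y => pd g y j) x i) 0 := by
    apply HasDerivAt.fun_sum
    intro j _
    apply HasDerivAt.const_mul
    have := (((pd_contDiff hg j).differentiable (by norm_num) (x + (0:ℝ) • W)).hasFDerivAt).comp_hasDerivAt 0 (hline 0)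
    rw [clm_coord] at this
    simpa [pd, Function.comp_def] using this
  have hS : ∑ i, ∑ j, w i * w j * pd (fun y => pd g y j) x i
      = ∑ j, w j * ∑ i, w i * pd (fun y => pd g y j) x i := by
    rw [Finset.sum_comm]
    refine Finset.sum_congr rfl fun j _ => ?_
    rw [Finset.mul_sum]
    refine Finset.sum_congr rfl fun i _ => ?_
    ring
  rw [hS]
  by_contra! hpos
  have hM : IsLocalMax (fun τ : ℝ => g (x + τ • W)) 0 := by
    refine Filter.Eventually.of_forall fun τ => ?_
    simpa using hmax (x + τ • W)
  have hm := isLocalMin_of_deriv_deriv_pos (f := fun τ : ℝ => g (x + τ • W)) (x₀ := 0)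
    (by rw [hd1, h2.deriv]; exact hpos) hM.deriv_eq_zero (h1 0).continuousAt
  have hc : (fun τ : ℝ => g (x + τ • W)) =ᶠ[nhds 0] fun _ => g (x + (0:ℝ) • W) := by
    filter_upwards [hM, hm] with τ a b
    exact le_antisymm a b
  have h3 := hc.deriv.deriv_eq
  rw [hd1, h2.deriv] at h3
  simp at h3
  simp [h3] at hpos

lemma pd_zero {d : ℕ} {g : Eu d → ℝ} {x : Eu d} (hmax : ∀ y, g y ≤ g x) (i : Fin d) :
    pd g x i = 0 := by
  have : IsLocalMax g x := Filter.Eventually.of_forall hmax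
  simp [pd, this.fderiv_eq_zero]

lemma exists_root {d : ℕ} {Q : Matrix (Fin d) (Fin d) ℝ} (hs : Q.IsSymm)
    (hp : ∀ w : Fin d → ℝ, 0 ≤ ∑ k, ∑ l, Q k l * w k * w l) :
    ∃ (N : ℕ) (R : Fin N → Fin d → ℝ), ∀ i j, Q i j = ∑ r, R r i * R r j := by
  have hpsd : Q.PosSemidef := by
    refine Matrix.PosSemidef.of_dotProduct_mulVec_nonneg ?_ ?_
    · rw [Matrix.IsHermitian, Matrix.conjTranspose_eq_transpose_of_trivial]; exact hs
    · intro w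
      refine (hp w).trans_eq ?_
      simp only [dotProduct, Matrix.mulVec, Finset.mul_sum]
      refine Finset.sum_congr rfl fun i _ => Finset.sum_congr rfl fun j _ => ?_
      change _ = w i * (Q i j * w j); ring
  obtain ⟨N, R, hR⟩ := Matrix.posSemidef_iff_eq_sum_vecMulVec.1 hpsd
  refine ⟨N, R, fun i j => ?_⟩
  rw [hR, Matrix.sum_apply]
  simp [Matrix.vecMulVec_apply]

lemma form_eq {d N : ℕ} {Q : Matrix (Fin d) (Fin d) ℝ} {R : Fin N → Fin d → ℝ} (hR : ∀ i j, Q i j = ∑ r, R r i * R r j)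
    (a : Fin d → ℝ) : ∑ i, ∑ j, Q i j * a i * a j = ∑ r, (∑ i, R r i * a i) ^ 2 := by
  simp only [sq, Finset.sum_mul_sum]; simp only [hR, Finset.sum_mul]
  rw [Finset.sum_comm_cycle]
  refine Finset.sum_congr rfl fun r _ => ?_
  refine Finset.sum_congr rfl fun i _ => Finset.sum_congr rfl fun j _ => ?_
  ring

lemma Lop_nonpos {d : ℕ} {q : Eu d → Matrix (Fin d) (Fin d) ℝ} {b : Fin d → ℝ}
    (hq : ∀ i j, ContDiff ℝ 1 (fun x => q x i j)) {g : Eu d → ℝ} (hg : ContDiff ℝ 2 g) {x : Eu d}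
    (hs : (q x).IsSymm) (hp : ∀ w : Fin d → ℝ, 0 ≤ ∑ k, ∑ l, q x k l * w k * w l)
    (hmax : ∀ y, g y ≤ g x) : Lop q b g x ≤ 0 := by
  unfold Lop
  simp only [pdq hq hg, pd_zero hmax, mul_zero, add_zero, Finset.sum_const_zero]
  obtain ⟨N, R, hR⟩ := exists_root hs hp
  have : ∑ i, ∑ j, q x i j * pd (fun y => pd g y j) x i
      = ∑ r, ∑ i, ∑ j, R r i * R r j * pd (fun y => pd g y j) x i := by
    simp only [hR, Finset.sum_mul]
    rw [Finset.sum_comm_cycle]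
  rw [this]
  exact Finset.sum_nonpos fun r _ => hess_nonpos hg hmax (R r)

lemma maxprinc {d : ℕ} {s T : ℝ} (Ψ : ℝ → Eu d → ℝ)
    (q : ℝ → Eu d → Matrix (Fin d) (Fin d) ℝ) (b : Fin d → ℝ → Eu d → ℝ)
    (hs : ∀ t ∈ Icc s T, ∀ x, (q t x).IsSymm)
    (hp : ∀ t ∈ Icc s T, ∀ x, ∀ w : Fin d → ℝ, 0 ≤ ∑ k, ∑ l, q t x k l * w k * w l)
    (hq : ∀ t ∈ Icc s T, ∀ i j, ContDiff ℝ 1 (fun x => q t x i j))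
    (hc : ContinuousOn (fun pt : ℝ × Eu d => Ψ pt.1 pt.2) (Icc s T ×ˢ univ))
    (h0 : ∀ x, Ψ s x ≤ 0)
    (K : Set (Eu d)) (hK : IsCompact K) (hKn : ∀ t ∈ Icc s T, ∀ x ∉ K, Ψ t x ≤ 0)
    (hreg : ∀ t ∈ Ioc s T, ContDiff ℝ 2 (Ψ t))
    (P : ℝ → Eu d → ℝ)
    (hder : ∀ t ∈ Ioc s T, ∀ x, HasDerivWithinAt (fun τ => Ψ τ x) (P t x) (Ioc s T) t)
    (hP : ∀ t ∈ Ioc s T, ∀ x, P t x < Lop (q t) (fun i => b i t x) (Ψ t) x) :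
    ∀ t ∈ Icc s T, ∀ x, Ψ t x ≤ 0 := by
  intro t1 ht1 x1
  by_contra! hpos
  have hx1 : x1 ∈ K := by
    by_contra h
    exact absurd (hKn t1 ht1 x1 h) (not_le.2 hpos)
  obtain ⟨⟨t0, x0⟩, ⟨ht0, hx0⟩, hmax⟩ := (isCompact_Icc.prod hK).exists_isMaxOn
    ⟨(t1, x1), ht1, hx1⟩ (hc.mono (prod_mono_right (subset_univ K)))
  simp only at ht0 hx0
  have hp0 : 0 < Ψ t0 x0 := lt_of_lt_of_le hpos (hmax (⟨ht1, hx1⟩ : (t1, x1) ∈ Icc s T ×ˢ K))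
  have hm : ∀ t ∈ Icc s T, ∀ x, Ψ t x ≤ Ψ t0 x0 := by
    intro t ht x
    by_cases hx : x ∈ K
    · exact hmax (⟨ht, hx⟩ : (t, x) ∈ Icc s T ×ˢ K)
    · exact (hKn t ht x hx).trans hp0.le
  have hst : s < t0 := by
    rcases ht0.1.eq_or_lt with h | h
    · exfalso; rw [← h] at hp0; exact absurd (h0 x0) (not_le.2 hp0)
    · exact h
  have ht0' : t0 ∈ Ioc s T := ⟨hst, ht0.2⟩
  have h1 := Lop_nonpos (b := fun i => b i t0 x0) (hq t0 ht0) (hreg t0 ht0') (hs t0 ht0 x0) (hp t0 ht0 x0) (hm t0 ht0)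
  have h2 := hP t0 ht0' x0
  have h3 : 0 ≤ P t0 x0 := by
    have hM : IsLocalMaxOn (fun τ => Ψ τ x0) (Ioc s T) t0 := by
      filter_upwards [self_mem_nhdsWithin] with τ hτ
      exact hm τ (Ioc_subset_Icc_self hτ) x0
    have hseg : segment ℝ t0 ((s + t0) / 2) ⊆ Ioc s T := by
      apply (convex_Ioc s T).segment_subset ht0'
      constructor <;> linarith [ht0.2]
    have := hM.hasFDerivWithinAt_nonpos (hder t0 ht0' x0).hasFDerivWithinAt
      (sub_mem_posTangentConeAt_of_segment_subset hseg)
    simp at this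
    nlinarith
  linarith

lemma alg_main {d m : ℕ} (hm : 1 ≤ m) (Q : Matrix (Fin d) (Fin d) ℝ) (lam x σ β H p Lc ε : ℝ)
    (hlam : 0 < lam) (hε : 0 < ε) (hH : 0 ≤ H) (hβ : 1 / 4 ≤ β)
    (hp : 1 + 1 / (4 * β) ≤ p ∧ p ≤ 2)
    (hQs : Q.IsSymm)
    (hQ : ∀ w : Fin d → ℝ, lam * ∑ k, (w k) ^ 2 ≤ ∑ k, ∑ l, Q k l * w k * w l)
    (B : Fin d → Matrix (Fin m) (Fin m) ℝ)
    (hB : ∀ i j k, |B i j k| ≤ x * lam ^ σ)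
    (C : Matrix (Fin m) (Fin m) ℝ)
    (hC : ∀ w : Fin m → ℝ, (∑ k, ∑ l, C k l * w k * w l) ≤ Lc * ∑ k, (w k) ^ 2)
    (hbd : Lc + β * d * m ^ 2 * x ^ 2 * lam ^ (2 * σ - 1) ≤ H)
    (u : Fin m → ℝ) (G : Fin d → Fin m → ℝ) :
    (∑ k, u k * ∑ i, ∑ l, B i k l * G i l) + (∑ k, u k * ∑ l, C k l * u l)
      - (∑ k, ∑ i, ∑ j, Q i j * G i k * G j k)
      + (2 - p) / (∑ k, u k ^ 2 + ε) *
        ∑ i, ∑ j, Q i j * (∑ k, u k * G i k) * (∑ k, u k * G j k)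
      ≤ H * (∑ k, u k ^ 2 + ε) := by
  set U := ∑ k, u k ^ 2 with hU
  have hU0 : 0 ≤ U := Finset.sum_nonneg fun _ _ => sq_nonneg _
  set N2 := ∑ k, ∑ i, G i k ^ 2 with hN2
  set Z := ∑ k, ∑ i, ∑ j, Q i j * G i k * G j k with hZ
  set Y := ∑ i, ∑ j, Q i j * (∑ k, u k * G i k) * (∑ k, u k * G j k) with hY
  have hβ0 : 0 < β := by linarith
  have hp1 : 0 < p - 1 := by
    have : 0 < 1 / (4 * β) := by positivity
    linarith [hp.1]
  have hpβ : 1 / (4 * (p - 1)) ≤ β := by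
    have h1 : 1 / (4 * β) ≤ p - 1 := by linarith [hp.1]
    rw [div_le_iff₀ (by positivity)] at h1 ⊢
    nlinarith
  have hmpos : (0:ℝ) < m := by exact_mod_cast hm
  -- ellipticity
  have hZ1 : lam * N2 ≤ Z := by
    rw [hN2, hZ, Finset.mul_sum]
    exact Finset.sum_le_sum fun k _ => hQ (fun i => G i k)
  -- Cauchy-Schwarz
  have hYZ : Y ≤ U * Z := by
    obtain ⟨N, R, hR⟩ := exists_root hQs (fun w => le_trans
      (mul_nonneg hlam.le (Finset.sum_nonneg fun _ _ => sq_nonneg _)) (hQ w))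
    have e1 : Y = ∑ r, (∑ i, R r i * ∑ k, u k * G i k) ^ 2 :=
      form_eq hR (fun i => ∑ k, u k * G i k)
    have e2 : Z = ∑ k, ∑ r, (∑ i, R r i * G i k) ^ 2 :=
      Finset.sum_congr rfl fun k _ => form_eq hR (fun i => G i k)
    rw [e1, e2, Finset.sum_comm, Finset.mul_sum]
    refine Finset.sum_le_sum fun r _ => ?_
    have e3 : ∑ i, R r i * ∑ k, u k * G i k = ∑ k, u k * ∑ i, R r i * G i k := by
      simp only [Finset.mul_sum]
      rw [Finset.sum_comm]
      refine Finset.sum_congr rfl fun k _ => Finset.sum_congr rfl fun i _ => ?_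
      ring
    rw [e3]
    exact Finset.sum_mul_sq_le_sq_mul_sq _ _ _
  have hZ0 : 0 ≤ Z := le_trans (mul_nonneg hlam.le
    (Finset.sum_nonneg fun _ _ => Finset.sum_nonneg fun _ _ => sq_nonneg _)) hZ1
  have hY2 : (2 - p) / (U + ε) * Y ≤ (2 - p) * Z := by
    rw [div_mul_eq_mul_div, div_le_iff₀ (by positivity), mul_assoc]
    apply mul_le_mul_of_nonneg_left _ (by linarith [hp.2])
    nlinarith
  have hC2 : (∑ k, u k * ∑ l, C k l * u l) ≤ Lc * U := by
    refine le_of_eq_of_le ?_ (hC u)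
    simp only [Finset.mul_sum]
    refine Finset.sum_congr rfl fun k _ => Finset.sum_congr rfl fun i _ => ?_
    ring
  -- first-order term
  set S := x * lam ^ σ with hS
  set c := (p - 1) * lam / m with hc
  have hcpos : 0 < c := by positivity
  have hB2 : (∑ k, u k * ∑ i, ∑ l, B i k l * G i l) ≤
      (p - 1) * lam * N2 + d * m * (S ^ 2 / (4 * c)) * U := by
    have hterm : ∀ i k l, u k * (B i k l * G i l) ≤ c * G i l ^ 2 + S ^ 2 / (4 * c) * u k ^ 2 := by
      intro i k l
      have hb := hB i k l
      have hb2 : B i k l ^ 2 ≤ S ^ 2 := by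
        rw [← sq_abs]; exact pow_le_pow_left₀ (abs_nonneg _) hb 2
      have h1 : u k * (B i k l * G i l) ≤ c * G i l ^ 2 + B i k l ^ 2 / (4 * c) * u k ^ 2 := by
        have : c * G i l ^ 2 + B i k l ^ 2 / (4 * c) * u k ^ 2 - u k * (B i k l * G i l)
          = (2 * c * G i l - B i k l * u k) ^ 2 / (4 * c) := by field_simp; ring
        have h0 : 0 ≤ (2 * c * G i l - B i k l * u k) ^ 2 / (4 * c) := by positivity
        linarith
      have h2 : B i k l ^ 2 / (4 * c) * u k ^ 2 ≤ S ^ 2 / (4 * c) * u k ^ 2 := by gcongr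
      linarith
    calc _ = ∑ k, ∑ i, ∑ l, u k * (B i k l * G i l) := by simp only [Finset.mul_sum]
      _ ≤ ∑ k : Fin m, ∑ i, ∑ l, (c * G i l ^ 2 + S ^ 2 / (4 * c) * u k ^ 2) :=
        Finset.sum_le_sum fun k _ => Finset.sum_le_sum fun i _ => Finset.sum_le_sum fun l _ =>
          hterm i k l
      _ = _ := by
        simp only [Finset.sum_add_distrib, Finset.sum_const, Finset.card_univ, Fintype.card_fin,
          nsmul_eq_mul, ← Finset.mul_sum]
        rw [← hU, Finset.sum_comm, ← hN2, hc]
        field_simp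
  have hS2 : d * m * (S ^ 2 / (4 * c)) ≤ β * d * m ^ 2 * x ^ 2 * lam ^ (2 * σ - 1) := by
    have e : S ^ 2 = x ^ 2 * lam ^ (2 * σ - 1) * lam := by
      rw [hS, mul_pow, Real.rpow_sub_one hlam.ne', two_mul, Real.rpow_add hlam]
      field_simp
    have e2 : d * m * (S ^ 2 / (4 * c)) = (1 / (4 * (p - 1))) * (d * m ^ 2 * x ^ 2 * lam ^ (2 * σ - 1)) := by
      rw [e, hc]
      field_simp
    rw [e2]
    have : 0 ≤ d * m ^ 2 * x ^ 2 * lam ^ (2 * σ - 1) := by positivity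
    calc _ ≤ β * (d * m ^ 2 * x ^ 2 * lam ^ (2 * σ - 1)) := by gcongr
      _ = _ := by ring
  have h5 := mul_le_mul_of_nonneg_right hS2 hU0
  have h6 := mul_le_mul_of_nonneg_right hbd hU0
  have h7 := mul_le_mul_of_nonneg_left hZ1 hp1.le
  nlinarith [mul_nonneg hH hε.le]

lemma pd_eq {d : ℕ} {g : Eu d → ℝ} {x : Eu d} {g' : Eu d →L[ℝ] ℝ} (h : HasFDerivAt g g' x)
    (i : Fin d) : pd g x i = g' (EuclideanSpace.single i 1) := by
  rw [pd, h.fderiv]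

lemma pd_w {d m : ℕ} (p ε : ℝ) (hε : 0 < ε) (u : Eu d → Fin m → ℝ)
    (hu : ∀ k, Differentiable ℝ (fun x => u x k)) (y : Eu d) (j : Fin d) :
    pd (fun x => (∑ k, u x k ^ 2 + ε) ^ (p / 2)) y j =
      p * (∑ k, u y k ^ 2 + ε) ^ (p / 2 - 1) * ∑ k, u y k * pd (fun z => u z k) y j := by
  have hpos : 0 < ∑ k, u y k ^ 2 + ε := by positivity
  have h1 : HasFDerivAt (fun x => ∑ k, u x k ^ 2 + ε)
      (∑ k, (2 * u y k) • fderiv ℝ (fun z => u z k) y) y := by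
    apply HasFDerivAt.add_const
    apply HasFDerivAt.fun_sum
    intro k _
    simpa using ((hu k y).hasFDerivAt).pow 2
  have h2 := h1.rpow_const (p := p / 2) (Or.inl hpos.ne')
  rw [pd_eq h2]
  simp only [smul_apply, sum_apply, smul_eq_mul, pd,
    Finset.mul_sum]
  refine Finset.sum_congr rfl fun k _ => ?_
  ring

lemma pd_sum {d m : ℕ} {g : Fin m → Eu d → ℝ} {x : Eu d} (hg : ∀ k, DifferentiableAt ℝ (g k) x)
    (i : Fin d) : pd (fun y => ∑ k, g k y) x i = ∑ k, pd (g k) x i := by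
  unfold pd
  rw [fderiv_fun_sum fun k _ => hg k]
  simp

lemma contDiff_w {d m : ℕ} (p ε : ℝ) (hε : 0 < ε) (u : Eu d → Fin m → ℝ)
    (hu : ∀ k, ContDiff ℝ 2 (fun x => u x k)) :
    ContDiff ℝ 2 (fun x => (∑ k, u x k ^ 2 + ε) ^ (p / 2)) := by
  apply ContDiff.rpow_const_of_ne
  · exact (ContDiff.sum fun k _ => (hu k).pow 2).add contDiff_const
  · intro x
    positivity

lemma pd2_w {d m : ℕ} (p ε : ℝ) (hε : 0 < ε) (u : Eu d → Fin m → ℝ)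
    (hu : ∀ k, ContDiff ℝ 2 (fun x => u x k)) (y : Eu d) (i j : Fin d) :
    pd (fun x => pd (fun x => (∑ k, u x k ^ 2 + ε) ^ (p / 2)) x j) y i =
      p * (∑ k, u y k ^ 2 + ε) ^ (p / 2 - 1) *
        ((∑ k, u y k * pd (fun z => pd (fun z => u z k) z j) y i) +
         (∑ k, pd (fun z => u z k) y i * pd (fun z => u z k) y j)
         - (2 - p) / (∑ k, u y k ^ 2 + ε) * ((∑ k, u y k * pd (fun z => u z k) y i) *
            (∑ k, u y k * pd (fun z => u z k) y j))) := by
  have hpos : 0 < ∑ k, u y k ^ 2 + ε := by positivity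
  have hd : ∀ k, Differentiable ℝ (fun x => u x k) := fun k => (hu k).differentiable (by norm_num)
  have hd2 : ∀ k, Differentiable ℝ (fun x => pd (fun z => u z k) x j) :=
    fun k => (pd_contDiff (hu k) j).differentiable (by norm_num)
  have hw : ∀ r : ℝ, Differentiable ℝ (fun x => (∑ k, u x k ^ 2 + ε) ^ (r / 2)) :=
    fun r => (contDiff_w r ε hε u hu).differentiable (by norm_num)
  have e : (fun x => pd (fun x => (∑ k, u x k ^ 2 + ε) ^ (p / 2)) x j) =
      fun x => (p * (∑ k, u x k ^ 2 + ε) ^ ((p - 2) / 2)) * ∑ k, u x k * pd (fun z => u z k) x j := by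
    funext x
    rw [pd_w p ε hε u hd x j, show p / 2 - 1 = (p - 2) / 2 by ring]
  have hdm : ∀ k, Differentiable ℝ (fun x => u x k * pd (fun z => u z k) x j) :=
    fun k => (hd k).fun_mul (hd2 k)
  rw [e, pd_mul (((hw (p - 2)).const_mul p) y)
    (DifferentiableAt.fun_sum fun k _ => hdm k y),
    pd_sum (fun k => hdm k y)]
  have e2 : pd (fun x => p * (∑ k, u x k ^ 2 + ε) ^ ((p - 2) / 2)) y i =
      p * pd (fun x => (∑ k, u x k ^ 2 + ε) ^ ((p - 2) / 2)) y i := by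
    unfold pd
    rw [fderiv_const_mul (hw (p - 2) y)]
    simp
  rw [e2, pd_w (p - 2) ε hε u hd y i]
  have e3 : ∀ k, pd (fun x => u x k * pd (fun z => u z k) x j) y i =
      u y k * pd (fun z => pd (fun z => u z k) z j) y i
        + pd (fun z => u z k) y i * pd (fun z => u z k) y j :=
    fun k => pd_mul (hd k y) (hd2 k y) i
  simp only [e3, Finset.sum_add_distrib]
  rw [Real.rpow_sub_one hpos.ne', show p / 2 - 1 = (p - 2) / 2 by ring]
  field_simp
  ring

lemma Lop_w {d m : ℕ} {q : Eu d → Matrix (Fin d) (Fin d) ℝ} {b : Fin d → ℝ}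
    (hq : ∀ i j, ContDiff ℝ 1 (fun x => q x i j)) (p ε : ℝ) (hε : 0 < ε) (u : Eu d → Fin m → ℝ)
    (hu : ∀ k, ContDiff ℝ 2 (fun x => u x k)) (y : Eu d) :
    Lop q b (fun x => (∑ k, u x k ^ 2 + ε) ^ (p / 2)) y =
      p * (∑ k, u y k ^ 2 + ε) ^ (p / 2 - 1) *
       ((∑ k, u y k * Lop q b (fun x => u x k) y)
        + (∑ k, ∑ i, ∑ j, q y i j * pd (fun z => u z k) y i * pd (fun z => u z k) y j)
        - (2 - p) / (∑ k, u y k ^ 2 + ε) * ∑ i, ∑ j, q y i j *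
          (∑ k, u y k * pd (fun z => u z k) y i) * (∑ k, u y k * pd (fun z => u z k) y j)) := by
  have hd : ∀ k, Differentiable ℝ (fun x => u x k) := fun k => (hu k).differentiable (by norm_num)
  have e1 : Lop q b (fun x => (∑ k, u x k ^ 2 + ε) ^ (p / 2)) y =
    (∑ i, ∑ j, (q y i j * pd (fun x => pd (fun x => (∑ k, u x k ^ 2 + ε) ^ (p / 2)) x j) y i
      + pd (fun y => q y i j) y i * pd (fun x => (∑ k, u x k ^ 2 + ε) ^ (p / 2)) y j))
     + ∑ i, b i * pd (fun x => (∑ k, u x k ^ 2 + ε) ^ (p / 2)) y i := by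
    unfold Lop
    simp only [pdq hq (contDiff_w p ε hε u hu)]
  have e2 : ∀ k, Lop q b (fun x => u x k) y =
    (∑ i, ∑ j, (q y i j * pd (fun x => pd (fun x => u x k) x j) y i
      + pd (fun y => q y i j) y i * pd (fun x => u x k) y j))
     + ∑ i, b i * pd (fun x => u x k) y i := by
    intro k
    unfold Lop
    simp only [pdq hq (hu k)]
  simp only [e1, e2, pd_w p ε hε u hd y, pd2_w p ε hε u hu y]
  have s1 : ∑ k, u y k * ((∑ i, ∑ j, (q y i j * pd (fun x => pd (fun x => u x k) x j) y i
      + pd (fun y => q y i j) y i * pd (fun x => u x k) y j))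
     + ∑ i, b i * pd (fun x => u x k) y i) =
     (∑ i, ∑ j, (q y i j * (∑ k, u y k * pd (fun x => pd (fun x => u x k) x j) y i)
      + pd (fun y => q y i j) y i * (∑ k, u y k * pd (fun x => u x k) y j)))
     + ∑ i, b i * (∑ k, u y k * pd (fun x => u x k) y i) := by
    simp only [mul_add, Finset.mul_sum, Finset.sum_add_distrib]
    congr 1
    · congr 1
      · rw [Finset.sum_comm]
        refine Finset.sum_congr rfl fun i _ => ?_
        rw [Finset.sum_comm]
        refine Finset.sum_congr rfl fun j _ => Finset.sum_congr rfl fun k _ => ?_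
        ring
      · rw [Finset.sum_comm]
        refine Finset.sum_congr rfl fun i _ => ?_
        rw [Finset.sum_comm]
        refine Finset.sum_congr rfl fun j _ => Finset.sum_congr rfl fun k _ => ?_
        ring
    · rw [Finset.sum_comm]
      refine Finset.sum_congr rfl fun j _ => Finset.sum_congr rfl fun k _ => ?_
      ring
  have s2 : (∑ k, ∑ i, ∑ j, q y i j * pd (fun z => u z k) y i * pd (fun z => u z k) y j) =
      ∑ i, ∑ j, q y i j * ∑ k, pd (fun z => u z k) y i * pd (fun z => u z k) y j := by
    rw [Finset.sum_comm]
    refine Finset.sum_congr rfl fun i _ => ?_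
    rw [Finset.sum_comm]
    refine Finset.sum_congr rfl fun j _ => ?_
    rw [Finset.mul_sum]
    refine Finset.sum_congr rfl fun k _ => ?_
    ring
  rw [s1, s2]
  generalize (∑ k, u y k ^ 2 + ε) = A
  rw [mul_sub, mul_add, mul_add, ← mul_assoc (p * A ^ (p / 2 - 1)) ((2 - p) / A)]
  simp only [Finset.mul_sum (s := (Finset.univ : Finset (Fin d)))]
  rw [add_right_comm, add_sub_right_comm]
  congr 1
  · rw [← Finset.sum_add_distrib, ← Finset.sum_sub_distrib]
    refine Finset.sum_congr rfl fun i _ => ?_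
    rw [← Finset.sum_add_distrib, ← Finset.sum_sub_distrib]
    refine Finset.sum_congr rfl fun j _ => ?_
    ring
  · refine Finset.sum_congr rfl fun i _ => ?_
    ring

lemma Lop_comb {d : ℕ} {q : Eu d → Matrix (Fin d) (Fin d) ℝ} {b : Fin d → ℝ}
    (hq : ∀ i j, ContDiff ℝ 1 (fun x => q x i j)) {g1 g2 g3 : Eu d → ℝ} (h1 : ContDiff ℝ 2 g1)
    (h2 : ContDiff ℝ 2 g2) (h3 : ContDiff ℝ 2 g3) {a k κ c : ℝ} {x : Eu d} :
    Lop q b (fun x => a * g1 x - g2 x - k - κ * (g3 x + c)) x =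
      a * Lop q b g1 x - Lop q b g2 x - κ * Lop q b g3 x := by
  have gen : ∀ {f1 f2 f3 : Eu d → ℝ} (_ : ContDiff ℝ 1 f1) (_ : ContDiff ℝ 1 f2)
      (_ : ContDiff ℝ 1 f3) (k c : ℝ) (y : Eu d) (j : Fin d),
      pd (fun x => a * f1 x - f2 x - k - κ * (f3 x + c)) y j =
        a * pd f1 y j - pd f2 y j - κ * pd f3 y j := by
    intro f1 f2 f3 h1 h2 h3 k c y j
    have e1 := (h1.differentiable (by norm_num) y).hasFDerivAt
    have e2 := (h2.differentiable (by norm_num) y).hasFDerivAt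
    have e3 := (h3.differentiable (by norm_num) y).hasFDerivAt
    rw [pd_eq ((((e1.const_mul a).fun_sub e2).sub_const k).fun_sub ((e3.add_const c).const_mul κ))]
    simp [pd]
  have hg : ContDiff ℝ 2 (fun x => a * g1 x - g2 x - k - κ * (g3 x + c)) :=
    (((contDiff_const.mul h1).sub h2).sub contDiff_const).sub
        (contDiff_const.mul (h3.add contDiff_const))
  have ed : ∀ y j, pd (fun x => a * g1 x - g2 x - k - κ * (g3 x + c)) y j =
        a * pd g1 y j - pd g2 y j - κ * pd g3 y j :=
    gen (h1.of_le (by norm_num)) (h2.of_le (by norm_num)) (h3.of_le (by norm_num)) k c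
  have ed2 : ∀ i j, pd (fun y => pd (fun x => a * g1 x - g2 x - k - κ * (g3 x + c)) y j) x i =
        a * pd (fun y => pd g1 y j) x i - pd (fun y => pd g2 y j) x i
          - κ * pd (fun y => pd g3 y j) x i := by
    intro i j
    simp only [ed]
    simpa using gen (pd_contDiff h1 j) (pd_contDiff h2 j) (pd_contDiff h3 j) 0 0 x i
  unfold Lop
  simp only [pdq hq hg, pdq hq h1, pdq hq h2, pdq hq h3, ed2]
  simp only [ed]
  simp only [mul_add, Finset.mul_sum]
  rw [add_sub_add_comm, add_sub_add_comm]
  simp only [← Finset.sum_sub_distrib]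
  congr 1
  · refine Finset.sum_congr rfl fun i _ => Finset.sum_congr rfl fun j _ => ?_
    ring
  · refine Finset.sum_congr rfl fun i _ => ?_
    ring

/-- Proposition 2.4 of the paper: pointwise estimate
`|u(t,x)|^p ≤ e^{pH(t−s)} v(t,x)`, where `u` is the bounded classical solution of the
vector-valued system `D_t u = 𝓐(t)u`, `u(s,·) = f`, and `v` is the bounded classical
solution of the scalar problem `D_t v = 𝒜(t)v`, `v(s,·) = |f|^p`. -/
theorem stmt_4 (d m : ℕ) (hd : 1 ≤ d) (hm : 1 ≤ m)
    (I : Set ℝ) (hI : I.OrdConnected)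
    (s T : ℝ) (hsT : s < T) (hJI : Icc s T ⊆ I)
    (ν₀ σ β H p : ℝ) (hν₀ : 0 < ν₀) (hσ : 0 < σ) (hβ : 1 / 4 ≤ β) (hH : 0 ≤ H)
    (hp : 1 + 1 / (4 * β) ≤ p ∧ p ≤ 2)
    (ξ : ℝ → ℝ) (hξ : ∀ t ∈ I, 0 < ξ t)
    (q : ℝ → EuclideanSpace ℝ (Fin d) → Matrix (Fin d) (Fin d) ℝ)
    (lamQ : ℝ → EuclideanSpace ℝ (Fin d) → ℝ)
    (hq_symm : ∀ t ∈ I, ∀ x, (q t x).IsSymm)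
    (hq_cont : ∀ i j : Fin d, ContinuousOn
      (fun pt : ℝ × EuclideanSpace ℝ (Fin d) => q pt.1 pt.2 i j)
      (I ×ˢ (univ : Set (EuclideanSpace ℝ (Fin d)))))
    (hq_reg : ∀ t ∈ I, ∀ i j : Fin d, ContDiff ℝ 1 (fun x => q t x i j))
    (hlamQ : ∀ t ∈ I, ∀ x, IsMinEigen (q t x) (lamQ t x) ∧ ν₀ ≤ lamQ t x)
    (b : Fin d → ℝ → EuclideanSpace ℝ (Fin d) → ℝ)
    (Btil : Fin d → ℝ → EuclideanSpace ℝ (Fin d) → Matrix (Fin m) (Fin m) ℝ)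
    (hB_cont : ∀ i : Fin d, ∀ k l : Fin m, ContinuousOn
      (fun pt : ℝ × EuclideanSpace ℝ (Fin d) =>
        b i pt.1 pt.2 * (1 : Matrix (Fin m) (Fin m) ℝ) k l + Btil i pt.1 pt.2 k l)
      (I ×ˢ (univ : Set (EuclideanSpace ℝ (Fin d)))))
    (hB_symm : ∀ i : Fin d, ∀ t ∈ I, ∀ x,
      (Matrix.IsSymm (b i t x • (1 : Matrix (Fin m) (Fin m) ℝ) + Btil i t x)))
    (hBtil : ∀ i : Fin d, ∀ t ∈ I, ∀ x, ∀ j k : Fin m,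
      |Btil i t x j k| ≤ ξ t * lamQ t x ^ σ)
    (C : ℝ → EuclideanSpace ℝ (Fin d) → Matrix (Fin m) (Fin m) ℝ)
    (LamC : ℝ → EuclideanSpace ℝ (Fin d) → ℝ)
    (hC_symm : ∀ t ∈ I, ∀ x, (C t x).IsSymm)
    (hC_cont : ∀ k l : Fin m, ContinuousOn
      (fun pt : ℝ × EuclideanSpace ℝ (Fin d) => C pt.1 pt.2 k l)
      (I ×ˢ (univ : Set (EuclideanSpace ℝ (Fin d)))))
    (hLamC : ∀ t ∈ I, ∀ x, IsMaxEigen (C t x) (LamC t x))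
    (hH_bound : ∀ t ∈ Icc s T, ∀ x,
      LamC t x + β * d * m ^ 2 * (ξ t) ^ 2 * lamQ t x ^ (2 * σ - 1) ≤ H)
    (lam₀ : ℝ) (hlam₀ : 0 < lam₀) (φ : EuclideanSpace ℝ (Fin d) → ℝ)
    (hφ_reg : ContDiff ℝ 2 φ) (hφ_pos : ∀ x, 0 < φ x)
    (hφ_blowup : Tendsto φ (cocompact (EuclideanSpace ℝ (Fin d))) atTop)
    (hφ_lyap : ∃ K : ℝ, ∀ t ∈ Icc s T, ∀ x,
      ((∑ i : Fin d, ∑ j : Fin d, pd (fun y => q t y i j * pd φ y j) x i) +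
        ∑ i : Fin d, b i t x * pd φ x i) - lam₀ * φ x ≤ K)
    (f : EuclideanSpace ℝ (Fin d) → Fin m → ℝ)
    (hf_cont : Continuous f) (hf_bdd : ∃ M : ℝ, ∀ x, ∑ k : Fin m, (f x k) ^ 2 ≤ M)
    (u : ℝ → EuclideanSpace ℝ (Fin d) → Fin m → ℝ)
    (hu_cont : ContinuousOn (fun pt : ℝ × EuclideanSpace ℝ (Fin d) => u pt.1 pt.2)
      (Icc s T ×ˢ (univ : Set (EuclideanSpace ℝ (Fin d)))))
    (hu_bdd : ∃ M : ℝ, ∀ t ∈ Icc s T, ∀ x, ∑ k : Fin m, (u t x k) ^ 2 ≤ M)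
    (hu_init : ∀ x, u s x = f x)
    (hu_reg : ∀ t ∈ Ioc s T, ContDiff ℝ 2 (u t))
    (hu_pde : ∀ t ∈ Ioc s T, ∀ x,
      HasDerivWithinAt (fun τ => u τ x)
        (fun k : Fin m =>
          (∑ i : Fin d, ∑ j : Fin d,
            pd (fun y => q t y i j * pd (fun z => u t z k) y j) x i) +
          (∑ i : Fin d, (b i t x * pd (fun z => u t z k) x i +
            ∑ l : Fin m, Btil i t x k l * pd (fun z => u t z l) x i)) +
          ∑ l : Fin m, C t x k l * u t x l)
        (Ioc s T) t)
    (v : ℝ → EuclideanSpace ℝ (Fin d) → ℝ)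
    (hv_cont : ContinuousOn (fun pt : ℝ × EuclideanSpace ℝ (Fin d) => v pt.1 pt.2)
      (Icc s T ×ˢ (univ : Set (EuclideanSpace ℝ (Fin d)))))
    (hv_bdd : ∃ M : ℝ, ∀ t ∈ Icc s T, ∀ x, |v t x| ≤ M)
    (hv_init : ∀ x, v s x = (∑ k : Fin m, (f x k) ^ 2) ^ (p / 2))
    (hv_reg : ∀ t ∈ Ioc s T, ContDiff ℝ 2 (v t))
    (hv_pde : ∀ t ∈ Ioc s T, ∀ x,
      HasDerivWithinAt (fun τ => v τ x)
        ((∑ i : Fin d, ∑ j : Fin d,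
          pd (fun y => q t y i j * pd (fun z => v t z) y j) x i) +
          ∑ i : Fin d, b i t x * pd (fun z => v t z) x i)
        (Ioc s T) t) :
    ∀ t ∈ Ioc s T, ∀ x,
      (∑ k : Fin m, (u t x k) ^ 2) ^ (p / 2) ≤ Real.exp (p * H * (t - s)) * v t x := by
  have hIm : ∀ t ∈ Icc s T, t ∈ I := fun t ht => hJI ht
  have hp0 : 0 < p := by
    have : 0 < 1 / (4 * β) := by
      have : 0 < β := by linarith
      positivity
    linarith [hp.1]
  have huk : ∀ t ∈ Ioc s T, ∀ k, ContDiff ℝ 2 (fun x => u t x k) :=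
    fun t ht k => contDiff_pi.1 (hu_reg t ht) k
  obtain ⟨K, hK⟩ := hφ_lyap
  obtain ⟨Mu, hMu⟩ := hu_bdd
  obtain ⟨Mv, hMv⟩ := hv_bdd
  set c : ℝ := |K| / lam₀ + 1 with hc
  have hcpos : 0 < c := by positivity
  have hcK : K < lam₀ * c := by
    have : lam₀ * c = |K| + lam₀ := by rw [hc]; field_simp
    rw [this]
    linarith [le_abs_self K]
  -- key estimate for fixed ε, δ
  have key : ∀ ε > 0, ∀ δ > 0, ∀ t ∈ Icc s T, ∀ x,
      Real.exp (-(p * H) * (t - s)) * (∑ k, u t x k ^ 2 + ε) ^ (p / 2) - v t x - ε ^ (p / 2)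
        - δ * Real.exp (lam₀ * (t - s)) * (φ x + c) ≤ 0 := by
    intro ε hε δ hδ
    have hev := hφ_blowup.eventually_ge_atTop (((Mu + ε) ^ (p / 2) + Mv) / δ)
    obtain ⟨K₁, hK₁, hK₁sub⟩ := mem_cocompact.1 hev
    refine maxprinc _ q b (fun t ht => hq_symm t (hIm t ht)) ?_ (fun t ht => hq_reg t (hIm t ht))
      ?_ ?_ K₁ hK₁ ?_ ?_ (fun t x =>
        ((-(p * H)) * Real.exp (-(p * H) * (t - s))) * (∑ k, u t x k ^ 2 + ε) ^ (p / 2)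
        + Real.exp (-(p * H) * (t - s)) * (p * (∑ k, u t x k ^ 2 + ε) ^ (p / 2 - 1) *
          ∑ k, u t x k * (Lop (q t) (fun i => b i t x) (fun z => u t z k) x
            + (∑ i, ∑ l, Btil i t x k l * pd (fun z => u t z l) x i)
            + ∑ l, C t x k l * u t x l))
        - Lop (q t) (fun i => b i t x) (v t) x
        - δ * (lam₀ * Real.exp (lam₀ * (t - s))) * (φ x + c)) ?_ ?_
    · intro t ht x w
      refine le_trans ?_ ((hlamQ t (hIm t ht) x).1.1 w)
      exact mul_nonneg (hν₀.le.trans (hlamQ t (hIm t ht) x).2)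
        (Finset.sum_nonneg fun _ _ => sq_nonneg _)
    · -- continuity
      have huc : ∀ k, ContinuousOn (fun pt : ℝ × Eu d => u pt.1 pt.2 k) (Icc s T ×ˢ univ) :=
        fun k => continuousOn_pi.1 hu_cont k
      have hexp : ∀ a : ℝ, Continuous (fun pt : ℝ × Eu d => Real.exp (a * (pt.1 - s))) := by
        intro a; fun_prop
      refine (((ContinuousOn.mul (hexp _).continuousOn ?_).sub hv_cont).sub
        continuousOn_const).sub (ContinuousOn.mul
          (continuousOn_const.mul (hexp _).continuousOn) ?_)
      · refine ContinuousOn.rpow_const ?_ (fun _ _ => Or.inr (by positivity))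
        exact (continuousOn_finsetSum _ fun k _ => (huc k).pow 2).add continuousOn_const
      · exact ((hφ_reg.continuous.comp continuous_snd).add continuous_const).continuousOn
    · intro x
      have h1 := Real.rpow_add_le_add_rpow (p := p / 2) (a := ∑ k, f x k ^ 2) (b := ε)
        (Finset.sum_nonneg fun _ _ => sq_nonneg _) hε.le (by positivity) (by linarith [hp.2])
      have h2 : 0 < δ * (φ x + c) := mul_pos hδ (add_pos (hφ_pos x) hcpos)
      simp only [hu_init, hv_init, sub_self, mul_zero, Real.exp_zero, one_mul, mul_one]
      linarith
    · intro t ht x hx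
      have h1 : ((Mu + ε) ^ (p / 2) + Mv) / δ ≤ φ x := hK₁sub hx
      rw [div_le_iff₀ hδ] at h1
      have h2 : Real.exp (-(p * H) * (t - s)) ≤ 1 := by
        rw [Real.exp_le_one_iff]
        nlinarith [mul_nonneg (mul_nonneg hp0.le hH) (sub_nonneg.2 ht.1)]
      have h3 : 1 ≤ Real.exp (lam₀ * (t - s)) :=
        Real.one_le_exp (mul_nonneg hlam₀.le (sub_nonneg.2 ht.1))
      have h4 : (∑ k, u t x k ^ 2 + ε) ^ (p / 2) ≤ (Mu + ε) ^ (p / 2) :=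
        Real.rpow_le_rpow (by positivity) (by linarith [hMu t ht x]) (by positivity)
      have h5 : 0 ≤ (∑ k, u t x k ^ 2 + ε) ^ (p / 2) := by positivity
      have h6 := mul_le_mul_of_nonneg_right h2 h5
      have h7 : δ * φ x ≤ δ * Real.exp (lam₀ * (t - s)) * (φ x + c) := by
        have := hφ_pos x
        rw [mul_assoc]
        apply mul_le_mul_of_nonneg_left _ hδ.le
        nlinarith
      have h8 : 0 ≤ ε ^ (p / 2) := by positivity
      have h9 := neg_abs_le (v t x)
      have h10 := hMv t ht x
      linarith
    · intro t ht
      have hw := contDiff_w p ε hε (u t) (huk t ht)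
      exact (((contDiff_const.mul hw).sub (hv_reg t ht)).sub contDiff_const).sub
        (contDiff_const.mul (hφ_reg.add contDiff_const))
    · intro t ht x
      have hexp : ∀ a : ℝ, HasDerivWithinAt (fun τ => Real.exp (a * (τ - s)))
          (a * Real.exp (a * (t - s))) (Ioc s T) t := by
        intro a
        have := (((hasDerivAt_id t).sub_const s).const_mul a).exp.hasDerivWithinAt (s := Ioc s T)
        simpa [mul_comm] using this
      have hpos : 0 < ∑ k, u t x k ^ 2 + ε := by positivity
      have hA : HasDerivWithinAt (fun τ => ∑ k, u τ x k ^ 2 + ε)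
          (∑ k, 2 * u t x k * (Lop (q t) (fun i => b i t x) (fun z => u t z k) x
            + (∑ i, ∑ l, Btil i t x k l * pd (fun z => u t z l) x i)
            + ∑ l, C t x k l * u t x l)) (Ioc s T) t := by
        apply HasDerivWithinAt.add_const
        apply HasDerivWithinAt.fun_sum
        intro k _
        have h1 := (hasDerivWithinAt_pi.1 (hu_pde t ht x) k).fun_pow 2
        refine h1.congr_deriv ?_
        simp only [Lop, Finset.sum_add_distrib]
        push_cast
        ring
      have hW := hA.rpow_const (p := p / 2) (Or.inl hpos.ne')
      have := ((((hexp (-(p * H))).fun_mul hW).fun_sub (hv_pde t ht x)).sub_const (ε ^ (p / 2))).fun_sub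
        (((hexp lam₀).const_mul δ).mul_const (φ x + c))
      refine this.congr_deriv ?_
      simp only [Lop, mul_assoc, ← Finset.mul_sum]
      ring
    · intro t ht x
      have ht' := Ioc_subset_Icc_self ht
      have htI := hIm t ht'
      have hw := contDiff_w p ε hε (u t) (huk t ht)
      rw [Lop_comb (hq_reg t htI) hw (hv_reg t ht) hφ_reg,
        Lop_w (hq_reg t htI) p ε hε (u t) (huk t ht)]
      have hpos : 0 < ∑ k, u t x k ^ 2 + ε := by positivity
      have hφ' : Lop (q t) (fun i => b i t x) φ x < lam₀ * (φ x + c) := by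
        have h1 := hK t ht' x
        unfold Lop
        linarith
      have hmain := alg_main hm (q t x) (lamQ t x) (ξ t) σ β H p (LamC t x) ε
        (hν₀.trans_le (hlamQ t htI x).2) hε hH hβ hp (hq_symm t htI x) (hlamQ t htI x).1.1
        (fun i => Btil i t x) (fun i j k => hBtil i t htI x j k) (C t x) (hLamC t htI x).1
        (hH_bound t ht' x) (u t x) (fun i k => pd (fun z => u t z k) x i)
      simp only [mul_add, Finset.sum_add_distrib] at hmain ⊢
      have hr : (∑ k, u t x k ^ 2 + ε) ^ (p / 2)
          = (∑ k, u t x k ^ 2 + ε) ^ (p / 2 - 1) * (∑ k, u t x k ^ 2 + ε) := by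
        rw [Real.rpow_sub_one hpos.ne']; field_simp
      rw [hr]
      have hAp : 0 < Real.exp (-(p * H) * (t - s)) * (p * (∑ k, u t x k ^ 2 + ε) ^ (p / 2 - 1)) := by
        positivity
      have h1 := mul_le_mul_of_nonneg_left hmain hAp.le
      have h2 := mul_lt_mul_of_pos_left hφ' (mul_pos hδ (Real.exp_pos (lam₀ * (t - s))))
      nlinarith
  have key2 : ∀ ε > 0, ∀ t ∈ Icc s T, ∀ x,
      Real.exp (-(p * H) * (t - s)) * (∑ k, u t x k ^ 2 + ε) ^ (p / 2) - v t x
        ≤ ε ^ (p / 2) := by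
    intro ε hε t ht x
    apply le_of_forall_pos_le_add
    intro η hη
    have hD : 0 < Real.exp (lam₀ * (t - s)) * (φ x + c) :=
      mul_pos (Real.exp_pos _) (add_pos (hφ_pos x) hcpos)
    have := key ε hε (η / (Real.exp (lam₀ * (t - s)) * (φ x + c))) (div_pos hη hD) t ht x
    rw [mul_assoc, div_mul_cancel₀ _ hD.ne'] at this
    linarith
  intro t ht x
  have ht' := Ioc_subset_Icc_self ht
  have key3 : Real.exp (-(p * H) * (t - s)) * (∑ k, u t x k ^ 2) ^ (p / 2) ≤ v t x := by
    apply le_of_forall_pos_le_add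
    intro η hη
    have h1 := key2 (η ^ (2 / p)) (by positivity) t ht' x
    rw [← Real.rpow_mul hη.le, show 2 / p * (p / 2) = 1 by field_simp, Real.rpow_one] at h1
    have h2 : (∑ k, u t x k ^ 2) ^ (p / 2) ≤ (∑ k, u t x k ^ 2 + η ^ (2 / p)) ^ (p / 2) := by
      apply Real.rpow_le_rpow (by positivity) _ (by positivity)
      linarith [Real.rpow_nonneg hη.le (2 / p)]
    have h3 := mul_le_mul_of_nonneg_left h2 (Real.exp_pos (-(p * H) * (t - s))).le
    linarith
  have h := mul_le_mul_of_nonneg_left key3 (Real.exp_pos (p * H * (t - s))).le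
  rw [← mul_assoc, ← Real.exp_add] at h
  simpa using h
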